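/- arXiv:1811.06371 — 2 statements merged into one kernel-verified Lean document; each statement's English description precedes it below -/
import Mathlib

section
/- (Goginava) Let n ∈ N and 0 < α ≤ 1. Then ∫_G max_{1 ≤ N < 2^n} ( A_{N−1}^α |K_N^{w,α}(x)| )^{1/(1+α)} dμ(x) ≥ c(α) · n / log(n+2), where c(α) > 0 depends only on α. -/
open MeasureTheory Filter Finset ENNReal

noncomputable section

/-- The Walsh group `G`: countable product of copies of `ℤ/2ℤ`. -/
abbrev WG : Type := ℕ → ZMod 2

/-- The normalized Haar measure (= product of uniform coin-toss measures) on `G`. -/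
def μW : Measure WG := Measure.addHaarMeasure ⊤

instance : (μW).Regular := by unfold μW; infer_instance

instance : IsFiniteMeasure μW := by
  constructor
  rw [← TopologicalSpace.PositiveCompacts.coe_top (α := WG)]
  exact IsCompact.measure_lt_top (⊤ : TopologicalSpace.PositiveCompacts WG).isCompact

/-- The product measure on `G^d`. -/
def μD (d : ℕ) : Measure (Fin d → WG) := Measure.pi fun _ => μW

/-- The `k`-th Rademacher function. -/
def rad (k : ℕ) (x : WG) : ℝ := (-1 : ℝ) ^ (x k).val

/-- The Walsh–Paley function of index `n`. -/
def walsh (n : ℕ) (x : WG) : ℝ :=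
  ∏ k ∈ Finset.range n.size, if n.testBit k then rad k x else 1

/-- The Walsh–Kaczmarz function of index `n`; `Nat.log 2 n` is the order `|n|`. -/
def kacz (n : ℕ) (x : WG) : ℝ :=
  if n = 0 then 1 else
    rad (Nat.log 2 n) x *
      (-1 : ℝ) ^ (∑ k ∈ Finset.range (Nat.log 2 n),
        (if n.testBit k then 1 else 0) * (x (Nat.log 2 n - 1 - k)).val)

/-- The `d`-dimensional Walsh–Kaczmarz function. -/
def kaczD (d : ℕ) (m : Fin d → ℕ) (x : Fin d → WG) : ℝ := ∏ i, kacz (m i) (x i)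

/-- Walsh–Paley Dirichlet kernel. -/
def dirW (n : ℕ) (x : WG) : ℝ := ∑ k ∈ Finset.range n, walsh k x

/-- Walsh–Kaczmarz Dirichlet kernel. -/
def dirK (n : ℕ) (x : WG) : ℝ := ∑ k ∈ Finset.range n, kacz k x

/-- `A_j^α = binom (j+α) j`. -/
def Abin (α : ℝ) (j : ℕ) : ℝ := ∏ i ∈ Finset.range j, (α + i + 1) / (i + 1)

/-- One-dimensional Walsh–Paley `(C,α)` kernel. -/
def KW (α : ℝ) (n : ℕ) (x : WG) : ℝ :=
  (Abin α n)⁻¹ * ∑ k ∈ Finset.range (n + 1), Abin (α - 1) (n - k) * dirW k x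

/-- One-dimensional Walsh–Kaczmarz `(C,α)` kernel. -/
def KK (α : ℝ) (n : ℕ) (x : WG) : ℝ :=
  (Abin α n)⁻¹ * ∑ k ∈ Finset.range (n + 1), Abin (α - 1) (n - k) * dirK k x

/-- The `m`-th Walsh–Kaczmarz–Fourier coefficient of `f : G^d → ℝ`. -/
def fCoeff (d : ℕ) (f : (Fin d → WG) → ℝ) (m : Fin d → ℕ) : ℝ :=
  ∫ x, f x * kaczD d m x ∂ μD d

/-- Rectangular partial sum built from an abstract family `c` of Fourier coefficients. -/
def partialSumOf (d : ℕ) (c : (Fin d → ℕ) → ℝ) (k : Fin d → ℕ) (x : Fin d → WG) : ℝ :=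
  ∑ m ∈ Fintype.piFinset (fun i => Finset.range (k i)), c m * kaczD d m x

/-- `(C,α)` (Cesàro) mean of order `n` built from coefficients `c`. -/
def cesaroOf (d : ℕ) (α : Fin d → ℝ) (c : (Fin d → ℕ) → ℝ) (n : Fin d → ℕ)
    (x : Fin d → WG) : ℝ :=
  (∏ i, Abin (α i) (n i))⁻¹ *
    ∑ k ∈ Fintype.piFinset (fun i => Finset.range (n i + 1)),
      (∏ i, Abin (α i - 1) (n i - k i)) * partialSumOf d c k x

/-- A cone-like restriction function (CRF) family `γ = (γ_j)_{j ≠ 0}`. -/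
structure IsCRF (d : ℕ) [NeZero d] (γ : Fin d → ℝ → ℝ) : Prop where
  strictMono : ∀ j : Fin d, j ≠ 0 → StrictMonoOn (γ j) (Set.Ici 1)
  contOn : ∀ j : Fin d, j ≠ 0 → ContinuousOn (γ j) (Set.Ici 1)
  one_le : ∀ j : Fin d, j ≠ 0 → ∀ x : ℝ, 1 ≤ x → 1 ≤ γ j x
  map_one : ∀ j : Fin d, j ≠ 0 → γ j 1 = 1
  tendsto_atTop : ∀ j : Fin d, j ≠ 0 → Tendsto (γ j) atTop atTop
  reg : ∃ ζ : ℝ, 1 < ζ ∧ ∀ j : Fin d, j ≠ 0 → ∃ c₁ c₂ : ℝ, 1 < c₁ ∧ 1 < c₂ ∧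
    ∀ x : ℝ, 1 ≤ x → c₁ * γ j x ≤ γ j (ζ * x) ∧ γ j (ζ * x) ≤ c₂ * γ j x

/-- The cone-like set `L` determined by `γ` and the parameters `β`. -/
def coneLike (d : ℕ) [NeZero d] (γ : Fin d → ℝ → ℝ) (β : Fin d → ℝ) : Set (Fin d → ℕ) :=
  {n | ∀ j : Fin d, j ≠ 0 → (β j)⁻¹ * γ j (n 0) ≤ (n j : ℝ) ∧ (n j : ℝ) ≤ β j * γ j (n 0)}

/-- `bar γ n₁ = (n₁, n₂, …, n_d)` where `n_j = |γ_j(2^{n₁})|` is the order of `γ_j(2^{n₁})`,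
i.e. `2^{n_j} ≤ γ_j(2^{n₁}) < 2^{n_j+1}`. -/
def bar (d : ℕ) [NeZero d] (γ : Fin d → ℝ → ℝ) (n₁ : ℕ) : Fin d → ℕ :=
  fun j => if j = 0 then n₁ else Nat.log 2 ⌊γ j ((2 : ℝ) ^ n₁)⌋₊

/-- The cone-like restricted maximal operator `σ_L^{κ,α,*}` (built from coefficients `c`). -/
def cesaroMaximal (d : ℕ) [NeZero d] (α : Fin d → ℝ) (γ : Fin d → ℝ → ℝ) (β : Fin d → ℝ)
    (c : (Fin d → ℕ) → ℝ) (x : Fin d → WG) : ℝ≥0∞ :=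
  ⨆ n ∈ coneLike d γ β, ENNReal.ofReal |cesaroOf d α c n x|

/-- `L^p`-"norm" (`0 < p < ∞`) of an `ℝ≥0∞`-valued function on `G^d`. -/
def lpNormE (d : ℕ) (p : ℝ) (g : (Fin d → WG) → ℝ≥0∞) : ℝ≥0∞ :=
  (∫⁻ x, g x ^ p ∂ μD d) ^ (1 / p)

/-- The dyadic rectangle `I_{N}(y) = I_{N_1}(y^1) × ⋯ × I_{N_d}(y^d)`. -/
def rectAt (d : ℕ) (N : Fin d → ℕ) (y : Fin d → WG) : Set (Fin d → WG) :=
  {x | ∀ j : Fin d, ∀ i : ℕ, i < N j → x j i = y j i}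

/-- The one-dimensional dyadic interval `I_N = I_N(0)`. -/
def rectW (N : ℕ) : Set WG := {x | ∀ i : ℕ, i < N → x i = 0}

/-- A one-parameter martingale with respect to the filtration
`(F_{bar γ n₁})_{n₁}` generated by the dyadic rectangles `I_{bar γ n₁}(y)`
(measurability w.r.t. this atomic σ-algebra = being constant on its rectangles,
and the martingale property = equality of integrals over the rectangles). -/
structure ConeMartingale (d : ℕ) [NeZero d] (γ : Fin d → ℝ → ℝ) where
  F : ℕ → (Fin d → WG) → ℝ
  integrable : ∀ n₁, Integrable (F n₁) (μD d)
  adapted : ∀ n₁ (x y : Fin d → WG),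
    (∀ j : Fin d, ∀ i : ℕ, i < bar d γ n₁ j → x j i = y j i) → F n₁ x = F n₁ y
  mart : ∀ n₁ m₁, n₁ ≤ m₁ → ∀ y,
    ∫ x in rectAt d (bar d γ n₁) y, F m₁ x ∂ μD d
      = ∫ x in rectAt d (bar d γ n₁) y, F n₁ x ∂ μD d

/-- The Fourier coefficients of a martingale (the integrals `∫ f_k ψ_m` stabilize). -/
def martCoeff (d : ℕ) [NeZero d] (γ : Fin d → ℝ → ℝ) (f : ConeMartingale d γ) (m : Fin d → ℕ) : ℝ :=
  limUnder atTop (fun k => ∫ x, f.F k x * kaczD d m x ∂ μD d)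

/-- The maximal function `f* = sup_{n₁} |f_{bar n₁}|` of a martingale. -/
def martMaximal (d : ℕ) [NeZero d] (γ : Fin d → ℝ → ℝ) (f : ConeMartingale d γ)
    (x : Fin d → WG) : ℝ≥0∞ :=
  ⨆ n₁ : ℕ, ENNReal.ofReal |f.F n₁ x|

/-- The martingale Hardy space "norm" `‖f‖_{H_p^γ} = ‖f*‖_p`. -/
def hardyNorm (d : ℕ) [NeZero d] (γ : Fin d → ℝ → ℝ) (p : ℝ) (f : ConeMartingale d γ) : ℝ≥0∞ :=
  lpNormE d p (martMaximal d γ f)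

/-- A `p`-atom supported on the rectangle `I_N(y)`. -/
structure IsPAtom (d : ℕ) (p : ℝ) (a : (Fin d → WG) → ℝ) (N : Fin d → ℕ)
    (y : Fin d → WG) : Prop where
  measurable : Measurable a
  support : ∀ x, x ∉ rectAt d N y → a x = 0
  bound : ∀ x, |a x| ≤ ((μD d (rectAt d N y)).toReal) ^ (-(1 / p))
  zero : ∫ x, a x ∂ μD d = 0

/-- The conditional-expectation (dyadic average) of `f` at level `N`. -/
def avgAt (d : ℕ) (N : Fin d → ℕ) (f : (Fin d → WG) → ℝ) (x : Fin d → WG) : ℝ :=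
  (2 : ℝ) ^ (∑ j, N j) * ∫ t in rectAt d N x, f t ∂ μD d

/-- `m` is the martingale generated by the integrable function `f`. -/
def inducedLevels (d : ℕ) [NeZero d] (γ : Fin d → ℝ → ℝ) (f : (Fin d → WG) → ℝ)
    (m : ConeMartingale d γ) : Prop :=
  ∀ n₁ x, m.F n₁ x = avgAt d (bar d γ n₁) f x

/-- The martingale maximal function of (the martingale generated by) a function `f`,
`f* = sup_{n₁} |S_{2^{bar γ n₁}} f|`. -/
def funMaximal (d : ℕ) [NeZero d] (γ : Fin d → ℝ → ℝ) (f : (Fin d → WG) → ℝ)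
    (x : Fin d → WG) : ℝ≥0∞ :=
  ⨆ n₁ : ℕ, ENNReal.ofReal |partialSumOf d (fCoeff d f) (fun j => 2 ^ bar d γ n₁ j) x|

/-- The Hardy norm `‖f‖_{H_p^γ}` of (the martingale generated by) a function `f`. -/
def funHardyNorm (d : ℕ) [NeZero d] (γ : Fin d → ℝ → ℝ) (p : ℝ) (f : (Fin d → WG) → ℝ) : ℝ≥0∞ :=
  lpNormE d p (funMaximal d γ f)

/-- Skvortsov's bit-reversal transformation `τ_A`. -/
def tau (A : ℕ) (x : WG) : WG := fun i => if i < A then x (A - 1 - i) else x i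

end

noncomputable section

lemma continuous_rad (k : ℕ) : Continuous (rad k) :=
  (continuous_of_discreteTopology (f := fun a : ZMod 2 => (-1 : ℝ) ^ a.val)).comp
    (continuous_apply k)

lemma continuous_walsh (n : ℕ) : Continuous (walsh n) := by
  unfold walsh
  refine continuous_finsetProd _ fun k _ => ?_
  split_ifs
  exacts [continuous_rad k, continuous_const]

lemma continuous_dirW (n : ℕ) : Continuous (dirW n) :=
  continuous_finsetSum _ fun k _ => continuous_walsh k

lemma continuous_KW (α : ℝ) (n : ℕ) : Continuous (KW α n) :=
  continuous_const.mul <| continuous_finsetSum _ fun k _ =>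
    continuous_const.mul (continuous_dirW k)

lemma Abin_pos {α : ℝ} (hα : -1 < α) (j : ℕ) : 0 < Abin α j :=
  prod_pos fun i _ => div_pos (by have : (0 : ℝ) ≤ i := i.cast_nonneg; linarith) (by positivity)

lemma Abin_succ (α : ℝ) (j : ℕ) : Abin α (j + 1) = Abin α j * ((α + j + 1) / (j + 1)) :=
  prod_range_succ _ _

lemma Abin_sub_one_succ (α : ℝ) (j : ℕ) :
    Abin (α - 1) (j + 1) = Abin α j * (α / (j + 1)) := by
  induction j with
  | zero => simp [Abin]
  | succ j ih =>
    rw [Abin_succ, ih, Abin_succ]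
    push_cast
    field_simp
    ring

lemma sum_Abin_sub_one (α : ℝ) (n : ℕ) :
    ∑ j ∈ range (n + 1), Abin (α - 1) j = Abin α n := by
  induction n with
  | zero => simp [Abin]
  | succ n ih =>
    rw [sum_range_succ, ih, Abin_sub_one_succ, Abin_succ]
    field_simp
    ring

lemma rpow_le_Abin {α : ℝ} (hα : 0 ≤ α) (hα1 : α ≤ 1) (n : ℕ) :
    ((n : ℝ) + 1) ^ α ≤ Abin α n := by
  induction n with
  | zero => simp [Abin]
  | succ n ih =>
    rw [Abin_succ]
    have hb := rpow_one_add_le_one_add_mul_self (s := 1 / ((n : ℝ) + 1))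
      (by have : (0 : ℝ) ≤ 1 / ((n : ℝ) + 1) := by positivity
          linarith) hα hα1
    calc (((n + 1 : ℕ) : ℝ) + 1) ^ α
        = ((n : ℝ) + 1) ^ α * (1 + 1 / ((n : ℝ) + 1)) ^ α := by
          rw [← Real.mul_rpow (by positivity) (by positivity)]
          congr 1
          push_cast
          field_simp
      _ ≤ Abin α n * (1 + α * (1 / ((n : ℝ) + 1))) :=
          mul_le_mul ih hb (by positivity) (Abin_pos (by linarith) n).le
      _ = _ := by
          congr 1
          field_simp
          ring

lemma half_rpow_le_sum_Abin {α : ℝ} (hα : 0 < α) (hα1 : α ≤ 1) (N : ℕ) :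
    ((N : ℝ) / 2) ^ (1 + α) ≤ ∑ k ∈ range (N + 1), Abin (α - 1) (N - k) * k := by
  have hpos : ∀ j, 0 ≤ Abin (α - 1) j := fun j => (Abin_pos (by linarith) j).le
  have hdiv : (N : ℝ) / 2 ≤ ((N / 2 : ℕ) : ℝ) + 1 := by
    have h : N ≤ 2 * (N / 2 + 1) := by omega
    have h' : (N : ℝ) ≤ 2 * (((N / 2 : ℕ) : ℝ) + 1) := by exact_mod_cast h
    linarith
  calc ((N : ℝ) / 2) ^ (1 + α) = ((N : ℝ) / 2) ^ α * ((N : ℝ) / 2) := by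
        rw [add_comm, Real.rpow_add_one' (by positivity) (by positivity)]
    _ ≤ Abin α (N / 2) * ((N : ℝ) / 2) := by
        gcongr
        exact (Real.rpow_le_rpow (by positivity) hdiv hα.le).trans (rpow_le_Abin hα.le hα1 _)
    _ = ∑ j ∈ range (N / 2 + 1), Abin (α - 1) j * ((N : ℝ) / 2) := by
        rw [← sum_Abin_sub_one, sum_mul]
    _ ≤ ∑ j ∈ range (N / 2 + 1), Abin (α - 1) j * ((N - j : ℕ) : ℝ) := by
        refine sum_le_sum fun j hj => mul_le_mul_of_nonneg_left ?_ (hpos j)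
        have hj' := mem_range.1 hj
        have h : N ≤ 2 * (N - j) := by omega
        have h' : (N : ℝ) ≤ 2 * ((N - j : ℕ) : ℝ) := by exact_mod_cast h
        linarith
    _ ≤ ∑ j ∈ range (N + 1), Abin (α - 1) j * ((N - j : ℕ) : ℝ) :=
        sum_le_sum_of_subset_of_nonneg (range_subset_range.2 (by omega))
          fun j _ _ => mul_nonneg (hpos j) (Nat.cast_nonneg _)
    _ = ∑ k ∈ range (N + 1), Abin (α - 1) (N - k) * k := by
        rw [← sum_range_reflect]
        refine sum_congr rfl fun k hk => ?_
        have hk' := mem_range.1 hk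
        rw [show N + 1 - 1 - k = N - k by omega, Nat.sub_sub_self (by omega)]

lemma walsh_eq_one {m k : ℕ} (hk : k < 2 ^ m) {x : WG} (hx : x ∈ rectW m) : walsh k x = 1 := by
  refine prod_eq_one fun i hi => ?_
  have him : i < m := (mem_range.1 hi).trans_le (Nat.size_le.2 hk)
  simp [rad, hx i him]

lemma dirW_eq_natCast {m k : ℕ} (hk : k ≤ 2 ^ m) {x : WG} (hx : x ∈ rectW m) :
    dirW k x = k := by
  unfold dirW
  rw [sum_congr rfl fun j hj => walsh_eq_one ((mem_range.1 hj).trans_le hk) hx]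
  simp

lemma Abin_pred_mul_abs_KW_ge {α : ℝ} (hα : 0 < α) (hα1 : α ≤ 1) {m : ℕ} {x : WG}
    (hx : x ∈ rectW m) :
    ((2 : ℝ) ^ m / 2) ^ (1 + α) / 2 ≤ Abin α (2 ^ m - 1) * |KW α (2 ^ m) x| := by
  obtain ⟨N, hN⟩ : ∃ N, 2 ^ m = N + 1 := Nat.exists_eq_add_one.2 (by positivity)
  have hsum : KW α (2 ^ m) x =
      (Abin α (2 ^ m))⁻¹ * ∑ k ∈ range (2 ^ m + 1), Abin (α - 1) (2 ^ m - k) * k := by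
    unfold KW
    congr 1
    refine sum_congr rfl fun k hk => ?_
    rw [dirW_eq_natCast (by have := mem_range.1 hk; omega) hx]
  have hS := half_rpow_le_sum_Abin hα hα1 (2 ^ m)
  push_cast at hS
  set S := ∑ k ∈ range (2 ^ m + 1), Abin (α - 1) (2 ^ m - k) * (k : ℝ) with hSdef
  have hS0 : 0 ≤ S := le_trans (by positivity) hS
  have hA := Abin_pos (show -1 < α by linarith) N
  have hA' := Abin_pos (show -1 < α by linarith) (N + 1)
  have hratio : 1 / 2 ≤ Abin α N * (Abin α (N + 1))⁻¹ := by
    rw [← div_eq_mul_inv, div_le_div_iff₀ two_pos hA', Abin_succ]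
    have hle : (α + N + 1) / ((N : ℝ) + 1) ≤ 2 := by
      rw [div_le_iff₀ (by positivity)]
      have : (0 : ℝ) ≤ N := N.cast_nonneg
      linarith
    nlinarith
  rw [hsum, hN, Nat.add_sub_cancel, abs_of_nonneg (mul_nonneg (inv_nonneg.2 hA'.le) hS0),
    ← mul_assoc]
  calc ((2 : ℝ) ^ m / 2) ^ (1 + α) / 2 ≤ 1 / 2 * S := by linarith
    _ ≤ _ := by gcongr

lemma isProbabilityMeasure_μW : IsProbabilityMeasure μW :=
  ⟨by
    rw [← TopologicalSpace.PositiveCompacts.coe_top (α := WG)]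
    exact Measure.addHaarMeasure_self⟩

instance : μW.IsAddLeftInvariant := by unfold μW; infer_instance

lemma measurableSet_rectW (m : ℕ) : MeasurableSet (rectW m) := by
  have : rectW m = ⋂ i, ⋂ (_ : i < m), (fun x : WG => x i) ⁻¹' {0} := by
    ext x
    simp [rectW]
  rw [this]
  exact .iInter fun i => .iInter fun _ => measurable_pi_apply i (MeasurableSet.singleton 0)

lemma rectW_succ_subset (m : ℕ) : rectW (m + 1) ⊆ rectW m :=
  fun _ hx i hi => hx i (hi.trans m.lt_succ_self)

lemma rectW_diff_eq_preimage (m : ℕ) :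
    rectW m \ rectW (m + 1) = (fun x => Pi.single m 1 + x) ⁻¹' rectW (m + 1) := by
  have hne : ∀ a : ZMod 2, a ≠ 0 ↔ 1 + a = 0 := by decide
  ext x
  simp only [rectW, Set.mem_sdiff, Set.mem_ofPred_eq, Set.mem_preimage, Pi.add_apply,
    Nat.lt_succ_iff_lt_or_eq]
  constructor
  · rintro ⟨h, h'⟩ i (hi | rfl)
    · simp [hi.ne, h i hi]
    · rw [Pi.single_eq_same, ← hne]
      rintro h0
      exact h' fun j hj => hj.elim (h j) (fun e => e ▸ h0)
  · intro h
    refine ⟨fun i hi => by simpa [hi.ne] using h i (.inl hi), fun h' => ?_⟩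
    have := h m (.inr rfl)
    rw [Pi.single_eq_same, ← hne] at this
    exact this (h' m (.inr rfl))

lemma measureReal_rectW_diff (m : ℕ) :
    μW.real (rectW m \ rectW (m + 1)) = μW.real (rectW (m + 1)) := by
  rw [rectW_diff_eq_preimage, measureReal_def, measureReal_def, measure_preimage_add]

lemma measureReal_rectW (m : ℕ) : μW.real (rectW m) = ((2 : ℝ) ^ m)⁻¹ := by
  have := isProbabilityMeasure_μW
  induction m with
  | zero => simp [rectW]
  | succ m ih =>
    have h := measureReal_sdiff_add_inter (μ := μW) (s := rectW m) (measurableSet_rectW (m + 1))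
    rw [Set.inter_eq_self_of_subset_right (rectW_succ_subset m), measureReal_rectW_diff, ih] at h
    rw [pow_succ, mul_inv]
    linarith

lemma pairwise_disjoint_rectW_diff :
    Pairwise (Function.onFun Disjoint fun m => rectW m \ rectW (m + 1)) := by
  refine (pairwise_disjoint_on _).2 fun m k hmk => Set.disjoint_left.2 fun x hx hx' => ?_
  exact hx.2 fun i hi => hx'.1 i (by omega)

/-- The maximal function `max_{1 ≤ N < 2ⁿ} A_{N-1}^α |K_N^{w,α}|`. -/
def maxKernel (α : ℝ) (n : ℕ) (x : WG) : ℝ :=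
  ⨆ N ∈ Finset.Ico 1 (2 ^ n), Abin α (N - 1) * |KW α N x|

lemma Abin_mul_abs_KW_nonneg {α : ℝ} (hα : -1 < α) (x : WG) (N : ℕ) : 0 ≤ Abin α (N - 1) * |KW α N x| :=
  mul_nonneg (Abin_pos hα _).le (abs_nonneg _)

lemma iSup_mem_le_sum {α : ℝ} (hα : -1 < α) (n : ℕ) (x : WG) (N : ℕ) :
    ⨆ (_ : N ∈ Finset.Ico 1 (2 ^ n)), Abin α (N - 1) * |KW α N x| ≤
      ∑ M ∈ Finset.Ico 1 (2 ^ n), Abin α (M - 1) * |KW α M x| :=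
  Real.iSup_le
    (fun h => single_le_sum (f := fun M => Abin α (M - 1) * |KW α M x|)
      (fun M _ => Abin_mul_abs_KW_nonneg hα x M) h)
    (sum_nonneg fun M _ => Abin_mul_abs_KW_nonneg hα x M)

lemma maxKernel_le_sum {α : ℝ} (hα : -1 < α) (n : ℕ) (x : WG) :
    maxKernel α n x ≤ ∑ N ∈ Finset.Ico 1 (2 ^ n), Abin α (N - 1) * |KW α N x| :=
  Real.iSup_le (iSup_mem_le_sum hα n x) (sum_nonneg fun M _ => Abin_mul_abs_KW_nonneg hα x M)

lemma le_maxKernel {α : ℝ} (hα : -1 < α) (n : ℕ) (x : WG) {N : ℕ}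
    (hN : N ∈ Finset.Ico 1 (2 ^ n)) :
    Abin α (N - 1) * |KW α N x| ≤ maxKernel α n x :=
  le_ciSup_of_le ⟨_, Set.forall_mem_range.2 (iSup_mem_le_sum hα n x)⟩ N
    (by rw [ciSup_pos hN])

lemma maxKernel_nonneg {α : ℝ} (hα : -1 < α) (n : ℕ) (x : WG) : 0 ≤ maxKernel α n x :=
  Real.iSup_nonneg fun N => Real.iSup_nonneg fun _ => Abin_mul_abs_KW_nonneg hα x N

lemma measurable_maxKernel (α : ℝ) (n : ℕ) : Measurable (maxKernel α n) :=
  Measurable.iSup fun N => Measurable.iSup fun _ =>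
    (continuous_const.mul (continuous_KW α N).abs).measurable

lemma integrable_maxKernel_rpow {α : ℝ} (hα : -1 < α) (n : ℕ) {p : ℝ} (hp : 0 ≤ p) :
    Integrable (fun x => maxKernel α n x ^ p) μW := by
  have hcont : Continuous fun x =>
      (∑ N ∈ Finset.Ico 1 (2 ^ n), Abin α (N - 1) * |KW α N x|) ^ p :=
    (continuous_finsetSum _ fun N _ => continuous_const.mul (continuous_KW α N).abs).rpow_const
      fun _ => .inr hp
  refine (hcont.integrable_of_hasCompactSupport (HasCompactSupport.of_compactSpace _)).mono'
    ((measurable_maxKernel α n).pow_const p).aestronglyMeasurable (.of_forall fun x => ?_)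
  rw [Real.norm_of_nonneg (Real.rpow_nonneg (maxKernel_nonneg hα n x) p)]
  exact Real.rpow_le_rpow (maxKernel_nonneg hα n x) (maxKernel_le_sum hα n x) hp

lemma two_pow_div_four_le_maxKernel_rpow {α : ℝ} (hα : 0 < α) (hα1 : α ≤ 1) {m n : ℕ}
    (hm : m < n) {x : WG} (hx : x ∈ rectW m) :
    (2 : ℝ) ^ m / 4 ≤ maxKernel α n x ^ (1 / (1 + α)) := by
  have hmem : 2 ^ m ∈ Finset.Ico 1 (2 ^ n) :=
    Finset.mem_Ico.2 ⟨Nat.one_le_two_pow, Nat.pow_lt_pow_right one_lt_two hm⟩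
  have hhalf : ((1 : ℝ) / 2) ^ (1 + α) ≤ 1 / 2 :=
    Real.rpow_le_self_of_le_one (by norm_num) (by norm_num) (by linarith)
  have hle : ((2 : ℝ) ^ m / 4) ^ (1 + α) ≤ maxKernel α n x :=
    calc ((2 : ℝ) ^ m / 4) ^ (1 + α) = ((2 : ℝ) ^ m / 2) ^ (1 + α) * (1 / 2) ^ (1 + α) := by
          rw [← Real.mul_rpow (by positivity) (by positivity)]
          ring_nf
      _ ≤ ((2 : ℝ) ^ m / 2) ^ (1 + α) * (1 / 2) := by gcongr
      _ = ((2 : ℝ) ^ m / 2) ^ (1 + α) / 2 := by ring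
      _ ≤ _ := Abin_pred_mul_abs_KW_ge hα hα1 hx
      _ ≤ _ := le_maxKernel (by linarith) n x hmem
  rw [one_div]
  exact (Real.le_rpow_inv_iff_of_pos (by positivity)
    (maxKernel_nonneg (by linarith) n x) (by linarith)).2 hle

lemma div_eight_le_integral_maxKernel_rpow {α : ℝ} (hα : 0 < α) (hα1 : α ≤ 1) (n : ℕ) :
    (n : ℝ) / 8 ≤ ∫ x, maxKernel α n x ^ (1 / (1 + α)) ∂μW := by
  have hint := integrable_maxKernel_rpow (show -1 < α by linarith) n
    (show 0 ≤ 1 / (1 + α) by positivity)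
  have hmeas : ∀ m, MeasurableSet (rectW m \ rectW (m + 1)) := fun m =>
    (measurableSet_rectW m).diff (measurableSet_rectW (m + 1))
  calc (n : ℝ) / 8 = ∑ m ∈ range n, (1 / 8 : ℝ) := by simp [div_eq_mul_inv]
    _ ≤ ∑ m ∈ range n, ∫ x in rectW m \ rectW (m + 1), maxKernel α n x ^ (1 / (1 + α)) ∂μW := by
        refine sum_le_sum fun m hm => ?_
        have h := setIntegral_ge_of_const_le_real (hmeas m) (measure_ne_top μW _)
          (fun x hx => two_pow_div_four_le_maxKernel_rpow hα hα1 (mem_range.1 hm) hx.1)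
          hint.integrableOn
        rw [measureReal_rectW_diff, measureReal_rectW] at h
        refine le_trans (le_of_eq ?_) h
        rw [pow_succ]
        field_simp
        norm_num
    _ = ∫ x in ⋃ m ∈ range n, rectW m \ rectW (m + 1), maxKernel α n x ^ (1 / (1 + α)) ∂μW :=
        (integral_biUnion_finset _ (fun m _ => hmeas m)
          (fun m _ k _ hmk => pairwise_disjoint_rectW_diff hmk)
          fun m _ => hint.integrableOn).symm
    _ ≤ _ := setIntegral_le_integral hint <| .of_forall fun x =>
        Real.rpow_nonneg (maxKernel_nonneg (by linarith) n x) _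

/-- Goginava's lemma: for `0 < α ≤ 1` there is `c(α) > 0` with
`∫_G (max_{1 ≤ N < 2ⁿ} A_{N-1}^α |K_N^{w,α}|)^{1/(1+α)} dμ ≥ c(α) · n / log(n+2)`. -/
theorem goginava_kernel_lower_bound (α : ℝ) (hα : 0 < α) (hα1 : α ≤ 1) :
    ∃ c : ℝ, 0 < c ∧ ∀ n : ℕ,
      c * n / Real.log (n + 2) ≤
        ∫ x, (⨆ N ∈ Finset.Ico 1 (2 ^ n), Abin α (N - 1) * |KW α N x|) ^ (1 / (1 + α))
          ∂ μW := by
  have hlog2 : 0 < Real.log 2 := Real.log_pos one_lt_two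
  refine ⟨Real.log 2 / 8, by positivity, fun n =>
    le_trans ?_ (div_eight_le_integral_maxKernel_rpow hα hα1 n)⟩
  have hlog : Real.log 2 ≤ Real.log (n + 2) :=
    Real.log_le_log two_pos (by have : (0 : ℝ) ≤ n := n.cast_nonneg; linarith)
  rw [div_le_iff₀ (hlog2.trans_le hlog)]
  have := mul_le_mul_of_nonneg_left hlog (show (0 : ℝ) ≤ n / 8 by positivity)
  linarith

end
end

section
/- For every n ≥ 1 and x ∈ G, the Walsh–Kaczmarz Dirichlet kernel satisfies D_n^κ(x) = D_{2^{|n|}}(x) + r_{|n|}(x) · D_{n − 2^{|n|}}^w(τ_{|n|}(x)), where τ_A(x) := (x_{A−1}, x_{A−2}, …, x_1, x_0, x_A, x_{A+1}, …) and D_{2^{|n|}} is the common 2^{|n|}th Dirichlet kernel of the two systems. -/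
open MeasureTheory Filter Finset ENNReal

noncomputable section

theorem walsh_eq_prod_range {n N : ℕ} (h : n < 2 ^ N) (x : WG) :
    walsh n x = ∏ k ∈ Finset.range N, if n.testBit k then rad k x else 1 := by
  refine Finset.prod_subset (Finset.range_mono (Nat.size_le.2 h)) fun k _ hk => ?_
  have hk' : n < 2 ^ k := Nat.size_le.1 (by simpa using hk)
  simp [Nat.testBit_lt_two_pow hk']

theorem walsh_two_pow_add {A m : ℕ} (h : m < 2 ^ A) (x : WG) :
    walsh (2 ^ A + m) x = rad A x * walsh m x := by
  rw [walsh_eq_prod_range (N := A + 1) (by rw [pow_succ]; omega), Finset.prod_range_succ,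
    walsh_eq_prod_range h, mul_comm]
  congr 1
  · simp [Nat.testBit_two_pow_add_eq, Nat.testBit_lt_two_pow h]
  · refine Finset.prod_congr rfl fun k hk => ?_
    rw [Nat.testBit_two_pow_add_gt (Finset.mem_range.1 hk)]

theorem kacz_two_pow_add {A m : ℕ} (h : m < 2 ^ A) (x : WG) :
    kacz (2 ^ A + m) x = rad A x * walsh m (tau A x) := by
  have hlog : Nat.log 2 (2 ^ A + m) = A :=
    Nat.log_eq_of_pow_le_of_lt_pow (by omega) (by rw [pow_succ]; omega)
  rw [kacz, if_neg (by positivity), hlog, walsh_eq_prod_range h, ← Finset.prod_pow_eq_pow_sum]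
  congr 1
  refine Finset.prod_congr rfl fun k hk => ?_
  have hk := Finset.mem_range.1 hk
  rw [Nat.testBit_two_pow_add_gt hk]
  split_ifs <;> simp [rad, tau, hk]

theorem dirW_two_pow_add {A m : ℕ} (h : m ≤ 2 ^ A) (x : WG) :
    dirW (2 ^ A + m) x = dirW (2 ^ A) x + rad A x * dirW m x := by
  simp only [dirW]
  rw [Finset.sum_range_add, Finset.mul_sum]
  congr 1
  exact Finset.sum_congr rfl fun k hk =>
    walsh_two_pow_add ((Finset.mem_range.1 hk).trans_le h) x

theorem dirK_two_pow_add {A m : ℕ} (h : m ≤ 2 ^ A) (x : WG) :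
    dirK (2 ^ A + m) x = dirK (2 ^ A) x + rad A x * dirW m (tau A x) := by
  simp only [dirK, dirW]
  rw [Finset.sum_range_add, Finset.mul_sum]
  congr 1
  exact Finset.sum_congr rfl fun k hk =>
    kacz_two_pow_add ((Finset.mem_range.1 hk).trans_le h) x

theorem dirW_two_pow (A : ℕ) (x : WG) :
    dirW (2 ^ A) x = ∏ k ∈ Finset.range A, (1 + rad k x) := by
  induction A with
  | zero => simp [dirW, walsh]
  | succ A ih =>
    rw [pow_succ, mul_two, dirW_two_pow_add le_rfl, Finset.prod_range_succ, ← ih]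
    ring

theorem dirW_two_pow_tau (A : ℕ) (x : WG) : dirW (2 ^ A) (tau A x) = dirW (2 ^ A) x := by
  rw [dirW_two_pow, dirW_two_pow, ← Finset.prod_range_reflect]
  refine Finset.prod_congr rfl fun k hk => ?_
  have hk := Finset.mem_range.1 hk
  have h₁ : A - 1 - k < A := by omega
  have h₂ : A - 1 - (A - 1 - k) = k := by omega
  simp [rad, tau, h₁, h₂]

theorem dirK_two_pow (A : ℕ) (x : WG) : dirK (2 ^ A) x = dirW (2 ^ A) x := by
  induction A with
  | zero => simp [dirW, dirK, walsh, kacz]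
  | succ A ih =>
    rw [pow_succ, mul_two, dirK_two_pow_add le_rfl, dirW_two_pow_add le_rfl, ih,
      dirW_two_pow_tau]

/-- `D_n^κ(x) = D_{2^{|n|}}(x) + r_{|n|}(x) D^w_{n-2^{|n|}}(τ_{|n|}(x))`
for all `n ≥ 1`, where `D_{2^{|n|}}` is the common `2^{|n|}`-th Dirichlet kernel of the
Walsh–Paley and Walsh–Kaczmarz systems. -/
theorem dirK_decomposition (n : ℕ) (hn : 1 ≤ n) (x : WG) :
    dirW (2 ^ Nat.log 2 n) x = dirK (2 ^ Nat.log 2 n) x ∧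
    dirK n x = dirW (2 ^ Nat.log 2 n) x +
      rad (Nat.log 2 n) x * dirW (n - 2 ^ Nat.log 2 n) (tau (Nat.log 2 n) x) := by
  have hle : 2 ^ Nat.log 2 n ≤ n := Nat.pow_log_le_self 2 (by omega)
  have hlt : n < 2 ^ (Nat.log 2 n + 1) := Nat.lt_pow_succ_log_self one_lt_two n
  refine ⟨(dirK_two_pow _ x).symm, ?_⟩
  rw [← dirK_two_pow, ← dirK_two_pow_add (by rw [pow_succ] at hlt; omega),
    Nat.add_sub_cancel' hle]

end
end
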